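/- Let d = 2 and define E : ℤ² → ℝ as follows, with M := max(|n₁|,|n₂|). If n₁+n₂ is even: E[n] = −(−1)^{n₁}·(|n₁+n₂|/2)(|n₁−n₂|/2)·₄F₃((2+n₁+n₂)/2, (2+n₁−n₂)/2, (2−n₁+n₂)/2, (2−n₁−n₂)/2; 1, 3/2, 3/2; 1) − ((−1)^{n₁}/π)·Σ_{μ=1}^{|n₁+n₂|/2} (−1)^μ·[Σ_{j=1}^{μ−1} 2/(2j−1) + 1/(2μ−1)]·₄F₃(|n₁+n₂|/2+1−μ, μ−|n₁+n₂|/2, (n₁−n₂)/2, (−n₁+n₂)/2; 1, 1/2, 1/2; 1) − ((−1)^{n₁}/π)·Σ_{ν=1}^{|n₁−n₂|/2} (−1)^ν·[Σ_{j=1}^{ν−1} 2/(2j−1) + 1/(2ν−1)]·₄F₃((n₁+n₂)/2, (−n₁−n₂)/2, |n₁−n₂|/2+1−ν, ν−|n₁−n₂|/2; 1, 1/2, 1/2; 1). If n₁+n₂ is odd: E[n] = ((−1)^M/4)·₄F₃((1+n₁+n₂)/2, (1+n₁−n₂)/2, (1−n₁+n₂)/2, (1−n₁−n₂)/2; 1,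 1/2, 1/2; 1) + ((−1)^M·|n₁−n₂|/π)·Σ_{μ=−(|n₁+n₂|−1)/2}^{(|n₁+n₂|−1)/2} (−1)^μ·(Σ_{j=1}^{|μ|} 1/(2j−1))·₄F₃((1+|n₁+n₂|)/2−|μ|, |μ|+(1−|n₁+n₂|)/2, (1+n₁−n₂)/2, (1−n₁+n₂)/2; 1, 1/2, 3/2; 1) + ((−1)^M·|n₁+n₂|/π)·Σ_{ν=−(|n₁−n₂|−1)/2}^{(|n₁−n₂|−1)/2} (−1)^ν·(Σ_{j=1}^{|ν|} 1/(2j−1))·₄F₃((1+n₁+n₂)/2, (1−n₁−n₂)/2, (1+|n₁−n₂|)/2−|ν|, |ν|+(1−|n₁−n₂|)/2; 1, 1/2, 3/2; 1). Then E is a fundamental solution to the two-dimensional discrete Laplacian: H₀E = δ₀, i.e. for every n ∈ ℤ², 4E[n] − E[n+e₁] − E[n−e₁] − E[n+e₂] − E[n−e₂] = δ₀[n]. -/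

import Mathlib

/-- The Pochhammer symbol `(q)_k = q (q+1) ⋯ (q+k-1)` on `ℝ`. -/
noncomputable def pochR (q : ℝ) (k : ℕ) : ℝ := ∏ j ∈ Finset.range k, (q + j)

/-- The generalized hypergeometric series `₄F₃(a₁,a₂,a₃,a₄; b₁,b₂,b₃; x)` over `ℝ`. -/
noncomputable def F43R (a₁ a₂ a₃ a₄ b₁ b₂ b₃ x : ℝ) : ℝ :=
  ∑' k : ℕ, pochR a₁ k * pochR a₂ k * pochR a₃ k * pochR a₄ k /
    (pochR b₁ k * pochR b₂ k * pochR b₃ k * (k.factorial : ℝ)) * x ^ k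

/-- The fundamental solution `E : ℤ² → ℝ` to the two-dimensional discrete Laplacian. -/
noncomputable def E (n : ℤ × ℤ) : ℝ :=
  if Even (n.1 + n.2) then
    -(-1 : ℝ) ^ n.1 * (((n.1 + n.2).natAbs / 2 : ℕ) : ℝ) * (((n.1 - n.2).natAbs / 2 : ℕ) : ℝ) *
      F43R ((2 + n.1 + n.2) / 2) ((2 + n.1 - n.2) / 2) ((2 - n.1 + n.2) / 2)
        ((2 - n.1 - n.2) / 2) 1 (3 / 2) (3 / 2) 1
    - (-1 : ℝ) ^ n.1 / Real.pi *
        ∑ μ ∈ Finset.Icc 1 ((n.1 + n.2).natAbs / 2),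
          (-1 : ℝ) ^ μ *
            ((∑ j ∈ Finset.Icc 1 (μ - 1), 2 / (2 * (j : ℝ) - 1)) + 1 / (2 * (μ : ℝ) - 1)) *
            F43R ((((n.1 + n.2).natAbs / 2 : ℕ) : ℝ) + 1 - μ)
              ((μ : ℝ) - (((n.1 + n.2).natAbs / 2 : ℕ) : ℝ))
              ((n.1 - n.2) / 2) ((-n.1 + n.2) / 2) 1 (1 / 2) (1 / 2) 1
    - (-1 : ℝ) ^ n.1 / Real.pi *
        ∑ ν ∈ Finset.Icc 1 ((n.1 - n.2).natAbs / 2),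
          (-1 : ℝ) ^ ν *
            ((∑ j ∈ Finset.Icc 1 (ν - 1), 2 / (2 * (j : ℝ) - 1)) + 1 / (2 * (ν : ℝ) - 1)) *
            F43R ((n.1 + n.2) / 2) ((-n.1 - n.2) / 2)
              ((((n.1 - n.2).natAbs / 2 : ℕ) : ℝ) + 1 - ν)
              ((ν : ℝ) - (((n.1 - n.2).natAbs / 2 : ℕ) : ℝ)) 1 (1 / 2) (1 / 2) 1
  else
    (-1 : ℝ) ^ (max n.1.natAbs n.2.natAbs) / 4 *
      F43R ((1 + n.1 + n.2) / 2) ((1 + n.1 - n.2) / 2) ((1 - n.1 + n.2) / 2)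
        ((1 - n.1 - n.2) / 2) 1 (1 / 2) (1 / 2) 1
    + (-1 : ℝ) ^ (max n.1.natAbs n.2.natAbs) * ((n.1 - n.2).natAbs : ℝ) / Real.pi *
        ∑ μ ∈ Finset.Icc (-((((n.1 + n.2).natAbs - 1) / 2 : ℕ) : ℤ))
            ((((n.1 + n.2).natAbs - 1) / 2 : ℕ) : ℤ),
          (-1 : ℝ) ^ μ * (∑ j ∈ Finset.Icc 1 μ.natAbs, 1 / (2 * (j : ℝ) - 1)) *
            F43R ((1 + ((n.1 + n.2).natAbs : ℝ)) / 2 - (μ.natAbs : ℝ))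
              ((μ.natAbs : ℝ) + (1 - ((n.1 + n.2).natAbs : ℝ)) / 2)
              ((1 + n.1 - n.2) / 2) ((1 - n.1 + n.2) / 2) 1 (1 / 2) (3 / 2) 1
    + (-1 : ℝ) ^ (max n.1.natAbs n.2.natAbs) * ((n.1 + n.2).natAbs : ℝ) / Real.pi *
        ∑ ν ∈ Finset.Icc (-((((n.1 - n.2).natAbs - 1) / 2 : ℕ) : ℤ))
            ((((n.1 - n.2).natAbs - 1) / 2 : ℕ) : ℤ),
          (-1 : ℝ) ^ ν * (∑ j ∈ Finset.Icc 1 ν.natAbs, 1 / (2 * (j : ℝ) - 1)) *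
            F43R ((1 + n.1 + n.2) / 2) ((1 - n.1 - n.2) / 2)
              ((1 + ((n.1 - n.2).natAbs : ℝ)) / 2 - (ν.natAbs : ℝ))
              ((ν.natAbs : ℝ) + (1 - ((n.1 - n.2).natAbs : ℝ)) / 2) 1 (1 / 2) (3 / 2) 1


namespace LatticeGreen

open Finset

lemma pochR_succ (q : ℝ) (k : ℕ) : pochR q (k + 1) = pochR q k * (q + k) := by
  simp [pochR, prod_range_succ]

lemma pochR_succ' (q : ℝ) (k : ℕ) : pochR q (k + 1) = q * pochR (q + 1) k := by
  simp only [pochR, prod_range_succ', Nat.cast_zero, add_zero]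
  rw [mul_comm]
  congr 1
  refine prod_congr rfl fun j _ => ?_
  push_cast
  ring

lemma pochR_zero (q : ℝ) : pochR q 0 = 1 := by simp [pochR]

lemma pochR_one (k : ℕ) : pochR 1 k = k.factorial := by
  induction k with
  | zero => simp [pochR]
  | succ k ih => rw [pochR_succ, ih, Nat.factorial_succ]; push_cast; ring

lemma pochR_pos {q : ℝ} (hq : 0 < q) (k : ℕ) : 0 < pochR q k :=
  prod_pos fun _ _ => by positivity

lemma pochR_neg_natCast {m k : ℕ} (h : m < k) : pochR (-(m : ℝ)) k = 0 :=
  prod_eq_zero (mem_range.2 h) (by ring)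

lemma pochR_three_halves (k : ℕ) : pochR (3 / 2) k = pochR (1 / 2) k * (2 * k + 1) := by
  have h := pochR_succ (1 / 2) k
  rw [pochR_succ'] at h
  norm_num at h ⊢
  linarith

/-- The coefficients of the Gauss series `₂F₁(a, b; c; s)`. -/
noncomputable def gaussCoeff (a b c : ℝ) (k : ℕ) : ℝ :=
  pochR a k * pochR b k / (pochR c k * k.factorial)

lemma gaussCoeff_comm (a b c : ℝ) (k : ℕ) : gaussCoeff a b c k = gaussCoeff b a c k := by
  simp only [gaussCoeff, mul_comm (pochR a k)]

/-- Coefficients in `s = sin² θ` of `cos (2 m θ)`. -/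
noncomputable def cosCoeff (m : ℝ) : ℕ → ℝ := gaussCoeff m (-m) (1 / 2)

/-- Coefficients in `s = sin² θ` of `cos ((2 m + 1) θ) / cos θ`. -/
noncomputable def cosDivCos (m : ℝ) : ℕ → ℝ := gaussCoeff (1 + m) (-m) (1 / 2)

/-- Coefficients in `s = sin² θ` of `sin ((2 m + 1) θ) / ((2 m + 1) sin θ)`. -/
noncomputable def sinDivSin (m : ℝ) : ℕ → ℝ := gaussCoeff (1 + m) (-m) (3 / 2)

/-- Coefficients in `s = sin² θ` of `sin (2 m θ) / (2 m sin θ cos θ)`. -/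
noncomputable def sinDivSinCos (m : ℝ) : ℕ → ℝ := gaussCoeff (1 + m) (1 - m) (3 / 2)

lemma gaussCoeff_zero (a b c : ℝ) : gaussCoeff a b c 0 = 1 := by simp [gaussCoeff, pochR_zero]

lemma cosCoeff_neg (m : ℝ) : cosCoeff (-m) = cosCoeff m := by
  funext k; simp only [cosCoeff, neg_neg]; exact gaussCoeff_comm _ _ _ _

lemma cosDivCos_reflect (m : ℝ) : cosDivCos (-m - 1) = cosDivCos m := by
  funext k
  simp only [cosDivCos]
  rw [gaussCoeff_comm]
  congr 1 <;> ring

lemma sinDivSin_reflect (m : ℝ) : sinDivSin (-m - 1) = sinDivSin m := by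
  funext k
  simp only [sinDivSin]
  rw [gaussCoeff_comm]
  congr 1 <;> ring

lemma sinDivSinCos_neg (m : ℝ) : sinDivSinCos (-m) = sinDivSinCos m := by
  funext k
  simp only [sinDivSinCos]
  rw [gaussCoeff_comm]
  congr 1; ring

lemma cosDivCos_natCast_eq_zero {m k : ℕ} (h : m < k) : cosDivCos m k = 0 := by
  simp [cosDivCos, gaussCoeff, pochR_neg_natCast h]

lemma sinDivSinCos_natCast_eq_zero {m k : ℕ} (hm : m ≠ 0) (h : m ≤ k) :
    sinDivSinCos m k = 0 := by
  obtain ⟨m, rfl⟩ := Nat.exists_eq_succ_of_ne_zero hm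
  simp [sinDivSinCos, gaussCoeff, pochR_neg_natCast (Nat.lt_of_succ_le h)]

lemma sinDivSin_sub (m : ℝ) (k : ℕ) :
    (2 * m + 1) * sinDivSin m k - (2 * m - 1) * sinDivSin (m - 1) k = 2 * cosCoeff m k := by
  have h1 := (pochR_pos (show (0 : ℝ) < 1 / 2 by norm_num) k).ne'
  have h2 : (k.factorial : ℝ) ≠ 0 := by positivity
  have h3 : (2 * k + 1 : ℝ) ≠ 0 := by positivity
  simp only [sinDivSin, cosCoeff, gaussCoeff, pochR_three_halves]
  cases k with
  | zero => norm_num [pochR_zero]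
  | succ k =>
    rw [pochR_succ (1 + m), pochR_succ' (-m), pochR_succ' m, pochR_succ' (1 + (m - 1)),
      pochR_succ (-(m - 1))]
    rw [show 1 + (m - 1) + 1 = 1 + m by ring, show -(m - 1) = -m + 1 by ring,
      show m + 1 = 1 + m by ring]
    field_simp
    push_cast
    ring

lemma cosCoeff_sub (m : ℝ) (k : ℕ) :
    cosCoeff (m + 1) (k + 1) - cosCoeff m (k + 1) = -2 * ((2 * m + 1) * sinDivSin m k) := by
  have h1 := (pochR_pos (show (0 : ℝ) < 1 / 2 by norm_num) k).ne'
  have h2 : (k.factorial : ℝ) ≠ 0 := by positivity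
  have h3 : (2 * k + 1 : ℝ) ≠ 0 := by positivity
  have h4 : (1 / 2 + k : ℝ) ≠ 0 := by positivity
  have h5 : (1 + 2 * k : ℝ) ≠ 0 := by positivity
  simp only [sinDivSin, cosCoeff, gaussCoeff, pochR_three_halves]
  rw [pochR_succ (1 / 2), Nat.factorial_succ, pochR_succ (m + 1), pochR_succ' (-(m + 1)),
    pochR_succ' m, pochR_succ (-m), show -(m + 1) + 1 = -m by ring, show m + 1 = 1 + m by ring]
  push_cast
  field_simp
  ring

lemma sinDivSinCos_sub (m : ℝ) (k : ℕ) :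
    (m + 1) * sinDivSinCos (m + 1) k - m * sinDivSinCos m k = cosDivCos m k := by
  have h1 := (pochR_pos (show (0 : ℝ) < 1 / 2 by norm_num) k).ne'
  have h2 : (k.factorial : ℝ) ≠ 0 := by positivity
  have h3 : (2 * k + 1 : ℝ) ≠ 0 := by positivity
  have e1 : (m + 1) * pochR (1 + (m + 1)) k = pochR (1 + m) k * (1 + m + k) := by
    rw [← pochR_succ, pochR_succ']; ring_nf
  have e2 : -m * pochR (1 - m) k = pochR (-m) k * (-m + k) := by
    rw [← pochR_succ, pochR_succ']; ring_nf
  simp only [sinDivSinCos, cosDivCos, gaussCoeff, pochR_three_halves]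
  rw [show 1 - (m + 1) = -m by ring]
  field_simp
  linear_combination pochR (-m) k * e1 + pochR (1 + m) k * e2

lemma cosDivCos_sub (m : ℝ) (k : ℕ) :
    cosDivCos m (k + 1) - cosDivCos (m - 1) (k + 1) = -4 * (m * sinDivSinCos m k) := by
  have h1 := (pochR_pos (show (0 : ℝ) < 1 / 2 by norm_num) k).ne'
  have h2 : (k.factorial : ℝ) ≠ 0 := by positivity
  have h3 : (2 * k + 1 : ℝ) ≠ 0 := by positivity
  have h4 : (1 / 2 + k : ℝ) ≠ 0 := by positivity
  have h5 : (1 + 2 * k : ℝ) ≠ 0 := by positivity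
  simp only [sinDivSinCos, cosDivCos, gaussCoeff, pochR_three_halves]
  rw [pochR_succ (1 / 2), Nat.factorial_succ, pochR_succ (1 + m), pochR_succ' (-m),
    pochR_succ' (1 + (m - 1)), pochR_succ (-(m - 1)), show 1 + (m - 1) + 1 = 1 + m by ring,
    show -(m - 1) = 1 - m by ring, show -m + 1 = 1 - m by ring]
  push_cast
  field_simp
  ring

lemma cosDivCos_second_difference (m : ℝ) (k : ℕ) :
    cosDivCos (m + 1) (k + 1) - 2 * cosDivCos m (k + 1) + cosDivCos (m - 1) (k + 1) =
      -4 * cosDivCos m k := by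
  have h1 := cosDivCos_sub m k
  have h2 := cosDivCos_sub (m + 1) k
  rw [add_sub_cancel_right] at h2
  linear_combination h2 - h1 - 4 * sinDivSinCos_sub m k

/-- `(-1) ^ μ` times the `μ`-th odd harmonic number. -/
noncomputable def weight (μ : ℕ) : ℝ := (-1) ^ μ * ∑ j ∈ Icc 1 μ, 1 / (2 * (j : ℝ) - 1)

lemma weight_zero : weight 0 = 0 := by simp [weight]

lemma weight_sub (μ : ℕ) :
    (-1 : ℝ) ^ (μ + 1) * ((∑ j ∈ Icc 1 μ, 2 / (2 * (j : ℝ) - 1)) +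
      1 / (2 * ((μ + 1 : ℕ) : ℝ) - 1)) = weight (μ + 1) - weight μ := by
  have : ∑ j ∈ Icc 1 μ, 2 / (2 * (j : ℝ) - 1) = 2 * ∑ j ∈ Icc 1 μ, 1 / (2 * (j : ℝ) - 1) := by
    rw [mul_sum]
    exact sum_congr rfl fun j _ => by ring
  rw [weight, weight, this, sum_Icc_succ_top (by omega)]
  ring

/-- Convolution of the weights with the sequence `cosDivCos`. -/
noncomputable def conv (M k : ℕ) : ℝ :=
  ∑ i ∈ range (M + 1), weight i * cosDivCos ((M : ℝ) - i) k

lemma conv_zero (k : ℕ) : conv 0 k = 0 := by simp [conv, weight_zero]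

lemma conv_eq_sum_Icc (M k : ℕ) :
    conv M k = ∑ μ ∈ Icc 1 M, weight μ * cosDivCos ((M : ℝ) - μ) k := by
  rw [conv, sum_range_succ', weight_zero, zero_mul, add_zero, ← Ico_add_one_right_eq_Icc,
    sum_Ico_eq_sum_range]
  simp [add_comm]

lemma conv_sub (M k : ℕ) :
    conv M k - conv (M - 1) k =
      ∑ μ ∈ Icc 1 M, (weight μ - weight (μ - 1)) * cosDivCos ((M : ℝ) - μ) k := by
  cases M with
  | zero => simp
  | succ M =>
    rw [← Ico_add_one_right_eq_Icc, sum_Ico_eq_sum_range, conv, sum_range_succ', weight_zero,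
      zero_mul, add_zero, add_tsub_cancel_right, conv, ← sum_sub_distrib]
    refine sum_congr (by simp) fun i _ => ?_
    rw [show ((M + 1 : ℕ) : ℝ) - ((i + 1 : ℕ) : ℝ) = M - i by push_cast; ring,
      show ((M + 1 : ℕ) : ℝ) - ((1 + i : ℕ) : ℝ) = M - i by push_cast; ring]
    simp only [add_comm 1 i, add_tsub_cancel_right]
    ring

lemma conv_second_difference (M k : ℕ) :
    (conv (M + 1) (k + 1) - conv M (k + 1)) - (conv M (k + 1) - conv (M - 1) (k + 1)) =
      -4 * conv M k := by
  have h0 : cosDivCos 0 (k + 1) = 0 := by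
    simpa using cosDivCos_natCast_eq_zero (Nat.succ_pos k)
  have hp : conv (M + 1) (k + 1) =
      ∑ i ∈ range (M + 1), weight i * cosDivCos ((M : ℝ) - i + 1) (k + 1) := by
    rw [conv, sum_range_succ, sub_self, h0, mul_zero, add_zero]
    refine sum_congr rfl fun i _ => ?_
    rw [show ((M + 1 : ℕ) : ℝ) - i = M - i + 1 by push_cast; ring]
  have hm : conv (M - 1) (k + 1) =
      ∑ i ∈ range (M + 1), weight i * cosDivCos ((M : ℝ) - i - 1) (k + 1) := by
    cases M with
    | zero => simp [conv, weight_zero]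
    | succ M =>
      have h1 : cosDivCos (-1) (k + 1) = 0 := by
        have := congrFun (cosDivCos_reflect 0) (k + 1)
        rw [h0] at this
        simpa using this
      rw [sum_range_succ _ (M + 1), sub_self, zero_sub, h1, mul_zero, add_zero,
        add_tsub_cancel_right, conv]
      refine sum_congr rfl fun i _ => ?_
      rw [show ((M + 1 : ℕ) : ℝ) - i - 1 = M - i by push_cast; ring]
  rw [hp, hm, conv, conv, mul_sum, ← sum_sub_distrib, ← sum_sub_distrib, ← sum_sub_distrib]
  refine sum_congr rfl fun i _ => ?_
  linear_combination weight i * cosDivCos_second_difference ((M : ℝ) - i) k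

/-- The rational part of `E` at `(|n₁ + n₂|, |n₁ - n₂|) = (2 M, 2 L)`. -/
noncomputable def ratEven (N M L : ℕ) : ℝ :=
  -(-1) ^ (M + L) * ∑ k ∈ range N, (M * sinDivSinCos M k) * (L * sinDivSinCos L k)

/-- The rational part of `E` at `(|n₁ + n₂|, |n₁ - n₂|) = (2 M + 1, 2 L + 1)`. -/
noncomputable def ratOdd (N M L : ℕ) : ℝ :=
  -(-1) ^ (M + L) / 4 * ∑ k ∈ range N, cosDivCos M k * cosDivCos L k

/-- One of the two symmetric terms in the coefficient of `1 / π` in `E` at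
`(|n₁ + n₂|, |n₁ - n₂|) = (2 M, 2 L)`. -/
noncomputable def piEven (N M L : ℕ) : ℝ :=
  -(-1) ^ (M + L) * ∑ k ∈ range N, (conv M k - conv (M - 1) k) * cosCoeff L k

/-- One of the two symmetric terms in the coefficient of `1 / π` in `E` at
`(|n₁ + n₂|, |n₁ - n₂|) = (2 M + 1, 2 L + 1)`. -/
noncomputable def piOdd (N M L : ℕ) : ℝ :=
  -(-1) ^ (M + L) * (2 * ∑ k ∈ range N, conv M k * ((2 * L + 1) * sinDivSin L k))

lemma piOdd_laplace (N M L : ℕ) :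
    4 * piOdd N M L = piEven (N + 1) M L + piEven (N + 1) (M + 1) L +
      piEven (N + 1) M (L + 1) + piEven (N + 1) (M + 1) (L + 1) := by
  have key : ∑ k ∈ range (N + 1), ((conv (M + 1) k - conv M k) - (conv M k - conv (M - 1) k)) *
      (cosCoeff (L + 1 : ℕ) k - cosCoeff L k) =
      8 * ∑ k ∈ range N, conv M k * ((2 * L + 1) * sinDivSin L k) := by
    rw [sum_range_succ', mul_sum]
    have : cosCoeff (L + 1 : ℕ) 0 - cosCoeff L 0 = 0 := by simp [cosCoeff, gaussCoeff_zero]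
    rw [this, mul_zero, add_zero]
    refine sum_congr rfl fun k _ => ?_
    rw [conv_second_difference, Nat.cast_succ, cosCoeff_sub]
    ring
  simp only [sub_mul, mul_sub, sum_sub_distrib] at key
  simp only [piOdd, piEven, add_tsub_cancel_right, sub_mul, sum_sub_distrib]
  linear_combination (-1 : ℝ) ^ (M + L) * key

lemma piEven_laplace (N M L : ℕ) :
    4 * piEven N M L = piOdd N M L + piOdd N (M - 1) L + piOdd N M (L - 1) +
      piOdd N (M - 1) (L - 1) := by
  rcases M.eq_zero_or_pos with rfl | hM
  · simp [piEven, piOdd, conv_zero]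
  obtain ⟨M, rfl⟩ := Nat.exists_eq_succ_of_ne_zero hM.ne'
  rcases L.eq_zero_or_pos with rfl | hL
  · have h0 : sinDivSin 0 = cosCoeff 0 := by
      funext k
      have h := sinDivSin_sub 0 k
      have := congrFun (sinDivSin_reflect 0) k
      norm_num at h this
      rw [this] at h
      linarith
    simp only [piOdd, piEven, Nat.succ_eq_add_one, add_tsub_cancel_right, sub_mul,
      sum_sub_distrib, Nat.cast_zero, h0, Nat.zero_sub, mul_zero, zero_add, one_mul]
    ring
  obtain ⟨L, rfl⟩ := Nat.exists_eq_succ_of_ne_zero hL.ne'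
  have key : ∑ k ∈ range N, (conv (M + 1) k - conv M k) *
      ((2 * (L + 1 : ℕ) + 1) * sinDivSin (L + 1 : ℕ) k - (2 * L + 1) * sinDivSin L k) =
      2 * ∑ k ∈ range N, (conv (M + 1) k - conv M k) * cosCoeff (L + 1 : ℕ) k := by
    rw [mul_sum]
    refine sum_congr rfl fun k _ => ?_
    have h := sinDivSin_sub (L + 1 : ℕ) k
    rw [show ((L + 1 : ℕ) : ℝ) - 1 = L by push_cast; ring] at h
    push_cast at h ⊢
    linear_combination (conv (M + 1) k - conv M k) * h
  simp only [sub_mul, mul_sub, sum_sub_distrib] at key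
  simp only [piOdd, piEven, Nat.succ_eq_add_one, add_tsub_cancel_right, sub_mul, sum_sub_distrib]
  linear_combination 2 * (-1 : ℝ) ^ (M + L) * key

lemma ratOdd_laplace (N M L : ℕ) :
    4 * ratOdd N M L = ratEven N M L + ratEven N (M + 1) L + ratEven N M (L + 1) +
      ratEven N (M + 1) (L + 1) := by
  have key : ∑ k ∈ range N, cosDivCos M k * cosDivCos L k = ∑ k ∈ range N,
      ((M + 1 : ℕ) * sinDivSinCos (M + 1 : ℕ) k - M * sinDivSinCos M k) *
      ((L + 1 : ℕ) * sinDivSinCos (L + 1 : ℕ) k - L * sinDivSinCos L k) := by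
    refine sum_congr rfl fun k _ => ?_
    rw [← sinDivSinCos_sub, ← sinDivSinCos_sub]
    push_cast
    rfl
  simp only [sub_mul, mul_sub, sum_sub_distrib] at key
  simp only [ratOdd, ratEven]
  linear_combination -(-1 : ℝ) ^ (M + L) * key

lemma ratOdd_comm (N M L : ℕ) : ratOdd N M L = ratOdd N L M := by
  simp only [ratOdd, add_comm M, mul_comm (cosDivCos M _)]

lemma sum_cosDivCos_zero_mul (N : ℕ) (f : ℕ → ℝ) :
    ∑ k ∈ range (N + 1), cosDivCos 0 k * f k = f 0 := by
  rw [sum_range_succ', sum_eq_zero, zero_add, cosDivCos, gaussCoeff_zero, one_mul]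
  intro k _
  have h : cosDivCos 0 (k + 1) = 0 := by
    simpa using cosDivCos_natCast_eq_zero (Nat.succ_pos k)
  rw [h, zero_mul]

lemma ratOdd_zero_left (N L : ℕ) : ratOdd (N + 1) 0 L = -(-1) ^ L / 4 := by
  rw [ratOdd, Nat.cast_zero, sum_cosDivCos_zero_mul, zero_add, cosDivCos, gaussCoeff_zero, mul_one]

lemma ratEven_laplace (N M L : ℕ) :
    4 * ratEven N M L - (ratOdd (N + 1) M L + ratOdd (N + 1) (M - 1) L + ratOdd (N + 1) M (L - 1) +
      ratOdd (N + 1) (M - 1) (L - 1)) = if M = 0 ∧ L = 0 then 1 else 0 := by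
  rcases M with _ | M <;> rcases L with _ | L
  · simp [ratEven, ratOdd_zero_left]; norm_num
  · simp [ratEven, ratOdd_zero_left]; ring
  · simp [ratEven, ratOdd_comm _ _ 0, ratOdd_zero_left]; ring
  · have key : ∑ k ∈ range (N + 1), (cosDivCos (M + 1 : ℕ) k - cosDivCos M k) *
        (cosDivCos (L + 1 : ℕ) k - cosDivCos L k) =
        16 * ∑ k ∈ range N, ((M + 1 : ℕ) * sinDivSinCos (M + 1 : ℕ) k) *
          ((L + 1 : ℕ) * sinDivSinCos (L + 1 : ℕ) k) := by
      rw [sum_range_succ', mul_sum]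
      have : cosDivCos (L + 1 : ℕ) 0 - cosDivCos L 0 = 0 := by simp [cosDivCos, gaussCoeff_zero]
      rw [this, mul_zero, add_zero]
      refine sum_congr rfl fun k _ => ?_
      have h1 := cosDivCos_sub (M + 1 : ℕ) k
      have h2 := cosDivCos_sub (L + 1 : ℕ) k
      rw [show ((M + 1 : ℕ) : ℝ) - 1 = M by push_cast; ring] at h1
      rw [show ((L + 1 : ℕ) : ℝ) - 1 = L by push_cast; ring] at h2
      rw [h1, h2]
      ring
    simp only [sub_mul, mul_sub, sum_sub_distrib] at key
    simp only [ratOdd, ratEven, add_tsub_cancel_right, Nat.add_eq_zero_iff, one_ne_zero, and_false,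
      if_false]
    linear_combination (-1 : ℝ) ^ (M + L) / 4 * key

lemma F43R_eq_sum {a₁ a₂ a₃ a₄ b c : ℝ} {N : ℕ}
    (h : ∀ k, N ≤ k → gaussCoeff a₁ a₂ b k * gaussCoeff a₃ a₄ c k = 0) :
    F43R a₁ a₂ a₃ a₄ 1 b c 1 =
      ∑ k ∈ range N, gaussCoeff a₁ a₂ b k * gaussCoeff a₃ a₄ c k := by
  rw [F43R, ← tsum_eq_sum (L := SummationFilter.unconditional ℕ)
    fun k hk => h k (not_lt.1 fun hlt => hk (mem_range.2 hlt))]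
  refine tsum_congr fun k => ?_
  rw [gaussCoeff, gaussCoeff, pochR_one, one_pow, mul_one, div_mul_div_comm]
  congr 1 <;> ring

lemma F43R_comm_upper (a₁ a₂ a₃ a₄ b₁ b₂ b₃ x : ℝ) :
    F43R a₁ a₂ a₃ a₄ b₁ b₂ b₃ x = F43R a₁ a₄ a₂ a₃ b₁ b₂ b₃ x := by
  refine tsum_congr fun k => ?_
  congr 2
  ring

lemma F43R_comm_pairs (a₁ a₂ a₃ a₄ b₁ b₂ b₃ x : ℝ) :
    F43R a₁ a₂ a₃ a₄ b₁ b₂ b₃ x = F43R a₃ a₄ a₁ a₂ b₁ b₃ b₂ x := by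
  refine tsum_congr fun k => ?_
  congr 2 <;> ring

lemma mul_F43R_eq_sum_sinDivSinCos {x y : ℝ} {M L N : ℕ} (hx : x = M ∨ x = -M)
    (hy : y = L ∨ y = -L) (hN : M ≤ N) :
    (M : ℝ) * L * F43R (1 + x) (1 + y) (1 - y) (1 - x) 1 (3 / 2) (3 / 2) 1 =
      ∑ k ∈ range N, (M * sinDivSinCos M k) * (L * sinDivSinCos L k) := by
  rcases eq_or_ne M 0 with rfl | hM
  · simp
  have ex : sinDivSinCos x = sinDivSinCos M := by
    rcases hx with rfl | rfl
    exacts [rfl, sinDivSinCos_neg _]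
  have ey : sinDivSinCos y = sinDivSinCos L := by
    rcases hy with rfl | rfl
    exacts [rfl, sinDivSinCos_neg _]
  rw [F43R_comm_upper, F43R_eq_sum (N := N), mul_sum]
  · refine sum_congr rfl fun k _ => ?_
    change M * L * (sinDivSinCos x k * sinDivSinCos y k) = _
    rw [ex, ey]
    ring
  · intro k hk
    change sinDivSinCos x k * _ = 0
    rw [ex, sinDivSinCos_natCast_eq_zero hM (hN.trans hk), zero_mul]

lemma F43R_eq_sum_cosDivCos {x y : ℝ} {M L N : ℕ} (hx : x = M ∨ x = -M - 1)
    (hy : y = L ∨ y = -L - 1) (hN : M < N) :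
    F43R (1 + x) (1 + y) (-y) (-x) 1 (1 / 2) (1 / 2) 1 =
      ∑ k ∈ range N, cosDivCos M k * cosDivCos L k := by
  have ex : cosDivCos x = cosDivCos M := by
    rcases hx with rfl | rfl
    exacts [rfl, cosDivCos_reflect _]
  have ey : cosDivCos y = cosDivCos L := by
    rcases hy with rfl | rfl
    exacts [rfl, cosDivCos_reflect _]
  rw [F43R_comm_upper, F43R_eq_sum (N := N)]
  · refine sum_congr rfl fun k _ => ?_
    change cosDivCos x k * cosDivCos y k = _
    rw [ex, ey]
  · intro k hk
    change cosDivCos x k * _ = 0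
    rw [ex, cosDivCos_natCast_eq_zero (hN.trans_le hk), zero_mul]

lemma F43R_eq_sum_cosDivCos_mul_cosCoeff {y : ℝ} {M L N μ : ℕ} (hμ : μ ≤ M)
    (hy : y = L ∨ y = -L) (hN : M < N) :
    F43R ((M : ℝ) + 1 - μ) (μ - M) y (-y) 1 (1 / 2) (1 / 2) 1 =
      ∑ k ∈ range N, cosDivCos ((M : ℝ) - μ) k * cosCoeff L k := by
  have ey : cosCoeff y = cosCoeff L := by
    rcases hy with rfl | rfl
    exacts [rfl, cosCoeff_neg _]
  rw [show (M : ℝ) + 1 - μ = 1 + ((M : ℝ) - μ) by ring, show (μ : ℝ) - M = -((M : ℝ) - μ) by ring,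
    F43R_eq_sum (N := N)]
  · refine sum_congr rfl fun k _ => ?_
    change cosDivCos _ k * cosCoeff y k = _
    rw [ey]
  · intro k hk
    change cosDivCos _ k * _ = 0
    rw [← Nat.cast_sub hμ, cosDivCos_natCast_eq_zero (by omega), zero_mul]

lemma F43R_eq_sum_cosDivCos_mul_sinDivSin {y : ℝ} {M L N μ : ℕ} (hμ : μ ≤ M)
    (hy : y = L ∨ y = -L - 1) (hN : M < N) :
    F43R (1 + ((M : ℝ) - μ)) (-((M : ℝ) - μ)) (1 + y) (-y) 1 (1 / 2) (3 / 2) 1 =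
      ∑ k ∈ range N, cosDivCos ((M : ℝ) - μ) k * sinDivSin L k := by
  have ey : sinDivSin y = sinDivSin L := by
    rcases hy with rfl | rfl
    exacts [rfl, sinDivSin_reflect _]
  rw [F43R_eq_sum (N := N)]
  · refine sum_congr rfl fun k _ => ?_
    change cosDivCos _ k * sinDivSin y k = _
    rw [ey]
  · intro k hk
    change cosDivCos _ k * _ = 0
    rw [← Nat.cast_sub hμ, cosDivCos_natCast_eq_zero (by omega), zero_mul]

lemma F43R_swap_half (a₁ a₂ a₃ a₄ : ℝ) :
    F43R a₁ a₂ a₃ a₄ 1 (1 / 2) (3 / 2) 1 = F43R a₃ a₄ a₁ a₂ 1 (1 / 2) (3 / 2) 1 := by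
  refine tsum_congr fun k => ?_
  congr 2
  ring

lemma piEven_eq {y : ℝ} {M L N : ℕ} (hy : y = L ∨ y = -L) (hN : M < N) :
    -(-1) ^ (M + L) * ∑ μ ∈ Icc 1 M, (-1 : ℝ) ^ μ *
      ((∑ j ∈ Icc 1 (μ - 1), 2 / (2 * (j : ℝ) - 1)) + 1 / (2 * (μ : ℝ) - 1)) *
      F43R ((M : ℝ) + 1 - μ) (μ - M) y (-y) 1 (1 / 2) (1 / 2) 1 = piEven N M L := by
  simp only [piEven, conv_sub, sum_mul]
  rw [sum_comm]
  congr 1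
  refine sum_congr rfl fun μ hμ => ?_
  obtain ⟨h1, h2⟩ := mem_Icc.1 hμ
  rw [F43R_eq_sum_cosDivCos_mul_cosCoeff h2 hy hN, mul_sum]
  obtain ⟨μ, rfl⟩ := Nat.exists_eq_succ_of_ne_zero (Nat.one_le_iff_ne_zero.1 h1)
  refine sum_congr rfl fun k _ => ?_
  rw [Nat.succ_eq_add_one, add_tsub_cancel_right, weight_sub]
  ring

lemma sum_Icc_natAbs {f : ℕ → ℝ} (hf : f 0 = 0) (M : ℕ) :
    ∑ μ ∈ Icc (-(M : ℤ)) M, f μ.natAbs = 2 * ∑ μ ∈ Icc 1 M, f μ := by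
  rw [sum_Icc_of_even_eq_range (f := fun μ : ℤ => f μ.natAbs) (fun μ => by simp)]
  simp only [Int.natAbs_natCast, Int.natAbs_zero, hf, sub_zero, nsmul_eq_mul, Nat.cast_ofNat]
  rw [sum_range_succ', hf, add_zero, ← Ico_add_one_right_eq_Icc, sum_Ico_eq_sum_range]
  simp [add_comm]

lemma neg_one_zpow_eq_pow_natAbs (μ : ℤ) : (-1 : ℝ) ^ μ = (-1) ^ μ.natAbs := by
  rcases Int.natAbs_eq μ with h | h <;> generalize μ.natAbs = m at h <;> subst h
  · simp
  · rw [zpow_neg, zpow_natCast, ← inv_pow, inv_neg_one]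

lemma piOdd_eq {y : ℝ} {M L N : ℕ} (hy : y = L ∨ y = -L - 1) (hN : M < N) :
    -(-1) ^ (M + L) * (2 * L + 1) * ∑ μ ∈ Icc (-(M : ℤ)) M, (-1 : ℝ) ^ μ *
      (∑ j ∈ Icc 1 μ.natAbs, 1 / (2 * (j : ℝ) - 1)) *
      F43R (1 + ((M : ℝ) - μ.natAbs)) (-((M : ℝ) - μ.natAbs)) (1 + y) (-y) 1 (1 / 2) (3 / 2) 1 =
      piOdd N M L := by
  simp only [neg_one_zpow_eq_pow_natAbs]
  rw [sum_Icc_natAbs (f := fun m : ℕ => (-1 : ℝ) ^ m * (∑ j ∈ Icc 1 m, 1 / (2 * (j : ℝ) - 1)) *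
    F43R (1 + ((M : ℝ) - m)) (-((M : ℝ) - m)) (1 + y) (-y) 1 (1 / 2) (3 / 2) 1) (by simp)]
  simp only [piOdd, conv_eq_sum_Icc, sum_mul]
  rw [sum_comm, mul_assoc, mul_left_comm (2 * (L : ℝ) + 1), mul_sum]
  congr 2
  refine sum_congr rfl fun μ hμ => ?_
  rw [F43R_eq_sum_cosDivCos_mul_sinDivSin (mem_Icc.1 hμ).2 hy hN, mul_sum, mul_sum]
  refine sum_congr rfl fun k _ => ?_
  rw [weight]
  ring

lemma E_of_even {n : ℤ × ℤ} {M L N₁ N₂ : ℕ} (hp : n.1 + n.2 = 2 * M ∨ n.1 + n.2 = -(2 * M))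
    (hq : n.1 - n.2 = 2 * L ∨ n.1 - n.2 = -(2 * L)) (h₁ : M < N₁) (h₂ : M < N₂) (h₃ : L < N₂) :
    E n = ratEven N₁ M L + (piEven N₂ M L + piEven N₂ L M) / Real.pi := by
  have hM : (n.1 + n.2).natAbs / 2 = M := by omega
  have hL : (n.1 - n.2).natAbs / 2 = L := by omega
  have hs : (-1 : ℝ) ^ n.1 = (-1) ^ (M + L) := by
    have hev : Even (n.1 - (M + L : ℕ)) := by rw [Int.even_iff]; omega
    rw [← sub_add_cancel n.1 (M + L : ℕ), zpow_add₀ (by norm_num), hev.neg_one_zpow, one_mul,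
      zpow_natCast]
  have hx : ((n.1 : ℝ) + n.2) / 2 = M ∨ ((n.1 : ℝ) + n.2) / 2 = -M := by
    refine hp.imp (fun h => ?_) fun h => ?_ <;>
    · have h_cast := congrArg (Int.cast (R := ℝ)) h
      push_cast at h_cast
      linarith
  have hy : ((n.1 : ℝ) - n.2) / 2 = L ∨ ((n.1 : ℝ) - n.2) / 2 = -L := by
    refine hq.imp (fun h => ?_) fun h => ?_ <;>
    · have h_cast := congrArg (Int.cast (R := ℝ)) h
      push_cast at h_cast
      linarith
  rw [E, if_pos (by rw [Int.even_iff]; omega), hM, hL, hs, ← piEven_eq hy h₂, ← piEven_eq hx h₃,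
    ratEven, ← mul_F43R_eq_sum_sinDivSinCos hx hy h₁.le, add_comm L M]
  rw [show (2 + (n.1 : ℝ) + n.2) / 2 = 1 + ((n.1 : ℝ) + n.2) / 2 by ring,
    show (2 + (n.1 : ℝ) - n.2) / 2 = 1 + ((n.1 : ℝ) - n.2) / 2 by ring,
    show (2 - (n.1 : ℝ) + n.2) / 2 = 1 - ((n.1 : ℝ) - n.2) / 2 by ring,
    show (2 - (n.1 : ℝ) - n.2) / 2 = 1 - ((n.1 : ℝ) + n.2) / 2 by ring,
    show (-(n.1 : ℝ) + n.2) / 2 = -(((n.1 : ℝ) - n.2) / 2) by ring,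
    show (-(n.1 : ℝ) - n.2) / 2 = -(((n.1 : ℝ) + n.2) / 2) by ring]
  simp only [F43R_comm_pairs (((n.1 : ℝ) + n.2) / 2)]
  ring

lemma E_of_odd {n : ℤ × ℤ} {M L N₁ N₂ : ℕ}
    (hp : n.1 + n.2 = 2 * M + 1 ∨ n.1 + n.2 = -(2 * M + 1))
    (hq : n.1 - n.2 = 2 * L + 1 ∨ n.1 - n.2 = -(2 * L + 1))
    (h₁ : M < N₁) (h₂ : M < N₂) (h₃ : L < N₂) :
    E n = ratOdd N₁ M L + (piOdd N₂ M L + piOdd N₂ L M) / Real.pi := by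
  have hM : (n.1 + n.2).natAbs = 2 * M + 1 := by omega
  have hL : (n.1 - n.2).natAbs = 2 * L + 1 := by omega
  have hmax : max n.1.natAbs n.2.natAbs = M + L + 1 := by omega
  have hx : ((n.1 : ℝ) + n.2 - 1) / 2 = M ∨ ((n.1 : ℝ) + n.2 - 1) / 2 = -M - 1 := by
    refine hp.imp (fun h => ?_) fun h => ?_ <;>
    · have h_cast := congrArg (Int.cast (R := ℝ)) h
      push_cast at h_cast
      linarith
  have hy : ((n.1 : ℝ) - n.2 - 1) / 2 = L ∨ ((n.1 : ℝ) - n.2 - 1) / 2 = -L - 1 := by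
    refine hq.imp (fun h => ?_) fun h => ?_ <;>
    · have h_cast := congrArg (Int.cast (R := ℝ)) h
      push_cast at h_cast
      linarith
  rw [E, if_neg (by rw [Int.even_iff]; omega), hM, hL, hmax, ← piOdd_eq hy h₂, ← piOdd_eq hx h₃,
    ratOdd, ← F43R_eq_sum_cosDivCos hx hy h₁, add_comm L M]
  have half (M : ℕ) : (2 * M + 1 - 1) / 2 = M := by omega
  simp only [half]
  have upper (M μ : ℕ) : (1 + ((2 * M + 1 : ℕ) : ℝ)) / 2 - μ = 1 + ((M : ℝ) - μ) := by
    push_cast; ring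
  have lower (M μ : ℕ) : (μ : ℝ) + (1 - ((2 * M + 1 : ℕ) : ℝ)) / 2 = -((M : ℝ) - μ) := by
    push_cast; ring
  simp only [upper, lower]
  rw [show (1 + (n.1 : ℝ) + n.2) / 2 = 1 + ((n.1 : ℝ) + n.2 - 1) / 2 by ring,
    show (1 + (n.1 : ℝ) - n.2) / 2 = 1 + ((n.1 : ℝ) - n.2 - 1) / 2 by ring,
    show (1 - (n.1 : ℝ) + n.2) / 2 = -(((n.1 : ℝ) - n.2 - 1) / 2) by ring,
    show (1 - (n.1 : ℝ) - n.2) / 2 = -(((n.1 : ℝ) + n.2 - 1) / 2) by ring]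
  simp only [F43R_swap_half (1 + ((n.1 : ℝ) + n.2 - 1) / 2)]
  push_cast
  ring

end LatticeGreen

open LatticeGreen in
/-- `E` is a fundamental solution to the two-dimensional discrete Laplacian: `H₀E = δ₀`. -/
theorem E_fundamental_solution (n : ℤ × ℤ) :
    4 * E n - E (n.1 + 1, n.2) - E (n.1 - 1, n.2) - E (n.1, n.2 + 1) - E (n.1, n.2 - 1) =
      if n = (0, 0) then 1 else 0 := by
  rcases Int.even_or_odd (n.1 + n.2) with he | ho
  · obtain ⟨p, hp⟩ := he
    obtain ⟨M, hM⟩ : ∃ M, M = p.natAbs := ⟨_, rfl⟩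
    obtain ⟨L, hL⟩ : ∃ L, L = (p - n.2).natAbs := ⟨_, rfl⟩
    have hr := ratEven_laplace (M + L + 1) M L
    have h1 := piEven_laplace (M + L + 2) M L
    have h2 := piEven_laplace (M + L + 2) L M
    have h0 : (n = (0, 0)) ↔ M = 0 ∧ L = 0 := by rw [Prod.ext_iff]; dsimp only; omega
    simp only [h0, ← hr]
    rw [E_of_even (n := n) (M := M) (L := L) (N₁ := M + L + 1) (N₂ := M + L + 2)
      (by omega) (by omega) (by omega) (by omega) (by omega)]
    have odd (m : ℤ × ℤ) (a b : ℕ) (ha : a ≤ M) (hb : b ≤ L)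
        (hp : m.1 + m.2 = 2 * a + 1 ∨ m.1 + m.2 = -(2 * a + 1))
        (hq : m.1 - m.2 = 2 * b + 1 ∨ m.1 - m.2 = -(2 * b + 1)) :=
      E_of_odd (N₁ := M + L + 2) (N₂ := M + L + 2) hp hq (by omega) (by omega) (by omega)
    rcases (show p = M ∨ p = -M by omega) with hx | hx <;>
    rcases (show p - n.2 = L ∨ p - n.2 = -L by omega) with hy | hy
    · rw [odd (n.1 + 1, n.2) M L, odd (n.1 - 1, n.2) (M - 1) (L - 1),
        odd (n.1, n.2 + 1) M (L - 1), odd (n.1, n.2 - 1) (M - 1) L]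
      · linear_combination (h1 + h2) / Real.pi
      all_goals omega
    · rw [odd (n.1 + 1, n.2) M (L - 1), odd (n.1 - 1, n.2) (M - 1) L,
        odd (n.1, n.2 + 1) M L, odd (n.1, n.2 - 1) (M - 1) (L - 1)]
      · linear_combination (h1 + h2) / Real.pi
      all_goals omega
    · rw [odd (n.1 + 1, n.2) (M - 1) L, odd (n.1 - 1, n.2) M (L - 1),
        odd (n.1, n.2 + 1) (M - 1) (L - 1), odd (n.1, n.2 - 1) M L]
      · linear_combination (h1 + h2) / Real.pi
      all_goals omega
    · rw [odd (n.1 + 1, n.2) (M - 1) (L - 1), odd (n.1 - 1, n.2) M L,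
        odd (n.1, n.2 + 1) (M - 1) L, odd (n.1, n.2 - 1) M (L - 1)]
      · linear_combination (h1 + h2) / Real.pi
      all_goals omega
  · obtain ⟨p, hp⟩ := ho
    obtain ⟨M, hM⟩ : ∃ M, M = (n.1 + n.2).natAbs / 2 := ⟨_, rfl⟩
    obtain ⟨L, hL⟩ : ∃ L, L = (n.1 - n.2).natAbs / 2 := ⟨_, rfl⟩
    have hr := ratOdd_laplace (M + L + 2) M L
    have h1 := piOdd_laplace (M + L + 1) M L
    have h2 := piOdd_laplace (M + L + 1) L M
    have h0 : n ≠ (0, 0) := by rw [Ne, Prod.ext_iff]; dsimp only; omega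
    rw [if_neg h0, E_of_odd (n := n) (M := M) (L := L) (N₁ := M + L + 2) (N₂ := M + L + 1)
      (by omega) (by omega) (by omega) (by omega) (by omega)]
    have even (m : ℤ × ℤ) (a b : ℕ) (ha : a ≤ M + 1) (hb : b ≤ L + 1)
        (hp : m.1 + m.2 = 2 * a ∨ m.1 + m.2 = -(2 * a))
        (hq : m.1 - m.2 = 2 * b ∨ m.1 - m.2 = -(2 * b)) :=
      E_of_even (N₁ := M + L + 2) (N₂ := M + L + 2) hp hq (by omega) (by omega) (by omega)
    rcases (show n.1 + n.2 = 2 * M + 1 ∨ n.1 + n.2 = -(2 * M + 1) by omega) with hx | hx <;>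
    rcases (show n.1 - n.2 = 2 * L + 1 ∨ n.1 - n.2 = -(2 * L + 1) by omega) with hy | hy
    · rw [even (n.1 + 1, n.2) (M + 1) (L + 1), even (n.1 - 1, n.2) M L,
        even (n.1, n.2 + 1) (M + 1) L, even (n.1, n.2 - 1) M (L + 1)]
      · linear_combination hr + (h1 + h2) / Real.pi
      all_goals omega
    · rw [even (n.1 + 1, n.2) (M + 1) L, even (n.1 - 1, n.2) M (L + 1),
        even (n.1, n.2 + 1) (M + 1) (L + 1), even (n.1, n.2 - 1) M L]
      · linear_combination hr + (h1 + h2) / Real.pi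
      all_goals omega
    · rw [even (n.1 + 1, n.2) M (L + 1), even (n.1 - 1, n.2) (M + 1) L,
        even (n.1, n.2 + 1) M L, even (n.1, n.2 - 1) (M + 1) (L + 1)]
      · linear_combination hr + (h1 + h2) / Real.pi
      all_goals omega
    · rw [even (n.1 + 1, n.2) M L, even (n.1 - 1, n.2) (M + 1) (L + 1),
        even (n.1, n.2 + 1) M (L + 1), even (n.1, n.2 - 1) (M + 1) L]
      · linear_combination hr + (h1 + h2) / Real.pi
      all_goals omega
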